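/- arXiv:2103.02271 — 3 statements merged into one kernel-verified Lean document; each statement's English description precedes it below -/
import Mathlib

section
/- For every k ≥ 3, the iterates of the distributed proximal gradient algorithm satisfy ∑_{i=1}^m ‖x_{i,k} − x_{i,k−1}‖ ≤ 2mΓ γ^{k−1} ∑_{i=1}^m ‖q_{i,k−1}‖ + α m (G_g + G_h); consequently ∑_{i=1}^m ‖x_{i,k} − x_{i,k−1}‖ ≤ 2mΓ ∑_{l=2}^{k−1} γ^l ∑_{i=1}^m ‖q_{i,l}‖ + (k−1) α m (G_g + G_h). -/
open scoped RealInnerProductSpace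
open Filter

section Prox

variable {E : Type*} [NormedAddCommGroup E] [InnerProductSpace ℝ E]

lemma nonneg_of_forall_add_mul_nonneg {a b : ℝ} (hb : 0 ≤ b)
    (hab : ∀ t : ℝ, 0 < t → t ≤ 1 → 0 ≤ a + t * b) : 0 ≤ a := by
  by_contra! ha
  have hpos : 0 < b - a := by linarith
  have key := hab (-a / (b - a)) (div_pos (by linarith) hpos)
    ((div_le_one hpos).2 (by linarith))
  have heq : a + -a / (b - a) * b = -(a * a) / (b - a) := by
    field_simp
    ring
  rw [heq, div_nonneg_iff] at key
  rcases key with h1 | h1 <;> nlinarith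

/-- First-order optimality for the proximal problem: `α⁻¹ • (w - p)` is a subgradient of `h`
at a minimizer `p`. -/
lemma prox_subgradient {h : E → ℝ} (hconv : ConvexOn ℝ Set.univ h) {α : ℝ} (hα : 0 < α) {w p : E}
    (hp : ∀ z, h p + (1 / (2 * α)) * ‖p - w‖ ^ 2 ≤ h z + (1 / (2 * α)) * ‖z - w‖ ^ 2) (u : E) :
    h p + ⟪α⁻¹ • (w - p), u - p⟫ ≤ h u := by
  have hinner : ⟪α⁻¹ • (w - p), u - p⟫ = -(α⁻¹ * ⟪p - w, u - p⟫) := by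
    rw [real_inner_smul_left, ← neg_sub p w, inner_neg_left, mul_neg]
  suffices 0 ≤ h u - h p + α⁻¹ * ⟪p - w, u - p⟫ by linarith
  refine nonneg_of_forall_add_mul_nonneg (b := 1 / (2 * α) * ‖u - p‖ ^ 2) (by positivity) ?_
  intro t ht0 ht1
  have hmin := hp (p + t • (u - p))
  have hcvx := hconv.2 (Set.mem_univ p) (Set.mem_univ u) (sub_nonneg.2 ht1) ht0.le (by ring)
  have hpt : (1 - t) • p + t • u = p + t • (u - p) := by module
  have hnorm : ‖p + t • (u - p) - w‖ ^ 2
      = ‖p - w‖ ^ 2 + 2 * (t * ⟪p - w, u - p⟫) + t ^ 2 * ‖u - p‖ ^ 2 := by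
    rw [show p + t • (u - p) - w = (p - w) + t • (u - p) by abel, norm_add_sq_real,
      real_inner_smul_right, norm_smul, mul_pow, Real.norm_eq_abs, sq_abs]
  rw [hpt, smul_eq_mul, smul_eq_mul] at hcvx
  rw [hnorm] at hmin
  have hexp : 1 / (2 * α) *
        (‖p - w‖ ^ 2 + 2 * (t * ⟪p - w, u - p⟫) + t ^ 2 * ‖u - p‖ ^ 2)
      = 1 / (2 * α) * ‖p - w‖ ^ 2
        + t * (α⁻¹ * ⟪p - w, u - p⟫ + t * (1 / (2 * α) * ‖u - p‖ ^ 2)) := by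
    field_simp
    ring
  refine nonneg_of_mul_nonneg_right ?_ ht0
  linarith

lemma prox_nonexpansive {h : E → ℝ} (hconv : ConvexOn ℝ Set.univ h) {α : ℝ} (hα : 0 < α)
    {w₁ w₂ p₁ p₂ : E}
    (hp₁ : ∀ z, h p₁ + (1 / (2 * α)) * ‖p₁ - w₁‖ ^ 2 ≤ h z + (1 / (2 * α)) * ‖z - w₁‖ ^ 2)
    (hp₂ : ∀ z, h p₂ + (1 / (2 * α)) * ‖p₂ - w₂‖ ^ 2 ≤ h z + (1 / (2 * α)) * ‖z - w₂‖ ^ 2) :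
    ‖p₁ - p₂‖ ≤ ‖w₁ - w₂‖ := by
  have h₁ := prox_subgradient hconv hα hp₁ p₂
  have h₂ := prox_subgradient hconv hα hp₂ p₁
  have hsum : ⟪α⁻¹ • (w₁ - p₁), p₂ - p₁⟫ + ⟪α⁻¹ • (w₂ - p₂), p₁ - p₂⟫
      = α⁻¹ * (‖p₁ - p₂‖ ^ 2 - ⟪w₁ - w₂, p₁ - p₂⟫) := by
    rw [← neg_sub p₁ p₂, inner_neg_right, real_inner_smul_left, real_inner_smul_left,
      ← real_inner_self_eq_norm_sq]
    simp only [inner_sub_left]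
    ring
  have hle : ‖p₁ - p₂‖ ^ 2 - ⟪w₁ - w₂, p₁ - p₂⟫ ≤ 0 :=
    nonpos_of_mul_nonpos_right (by linarith : α⁻¹ * _ ≤ 0) (inv_pos.2 hα)
  have hcs := real_inner_le_norm (w₁ - w₂) (p₁ - p₂)
  by_contra! hlt
  nlinarith [norm_nonneg (w₁ - w₂)]

end Prox

section Averaging

variable {E : Type*} [NormedAddCommGroup E] [NormedSpace ℝ E] {ι : Type*} [Fintype ι]

/-- Two linear combinations whose weights are both within `δ` of a common value `c`. -/
lemma norm_sum_smul_sub_sum_smul_le {a b : ι → ℝ} {c δ : ℝ} (ha : ∀ l, |a l - c| ≤ δ)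
    (hb : ∀ l, |b l - c| ≤ δ) (y : ι → E) :
    ‖∑ l, a l • y l - ∑ l, b l • y l‖ ≤ 2 * δ * ∑ l, ‖y l‖ := by
  rw [← Finset.sum_sub_distrib, Finset.mul_sum]
  refine norm_sum_le_of_le _ fun l _ ↦ ?_
  rw [← sub_smul, norm_smul, Real.norm_eq_abs]
  gcongr
  calc |a l - b l| ≤ |a l - c| + |c - b l| := abs_sub_le _ _ _
    _ ≤ 2 * δ := by rw [abs_sub_comm c]; linarith [ha l, hb l]

lemma norm_sum_smul_sub_le {a : ι → ℝ} (ha : ∀ j, 0 ≤ a j) (hsum : ∑ j, a j = 1)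
    {y : ι → E} {z : E} {D : ℝ} (hD : ∀ j, ‖y j - z‖ ≤ D) :
    ‖∑ j, a j • y j - z‖ ≤ D := by
  have hz : ∑ j, a j • y j - z = ∑ j, a j • (y j - z) := by
    simp only [smul_sub, Finset.sum_sub_distrib]
    rw [← Finset.sum_smul, hsum, one_smul]
  calc ‖∑ j, a j • y j - z‖ ≤ ∑ j, a j * D := by
        rw [hz]
        refine norm_sum_le_of_le _ fun j _ ↦ ?_
        rw [norm_smul, Real.norm_of_nonneg (ha j)]
        exact mul_le_mul_of_nonneg_left (hD j) (ha j)
    _ = D := by rw [← Finset.sum_mul, hsum, one_mul]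

end Averaging

theorem stmt_6
    (n m : ℕ) (hn : 0 < n) (hm : 1 ≤ m)
    (g : Fin m → EuclideanSpace ℝ (Fin n) → ℝ)
    (G : Fin m → EuclideanSpace ℝ (Fin n) → EuclideanSpace ℝ (Fin n))
    (L Gg Gh α : ℝ) (hL : 0 < L)
    (hgrad : ∀ i x, HasGradientAt (g i) (G i x) x)
    (hLip : ∀ i x y, ‖G i x - G i y‖ ≤ L * ‖x - y‖)
    (hGg : ∀ i x, ‖G i x‖ ≤ Gg)
    (h : EuclideanSpace ℝ (Fin n) → ℝ)
    (hconv : ConvexOn ℝ Set.univ h)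
    (hGh : 0 < Gh)
    (hsub : ∀ x z : EuclideanSpace ℝ (Fin n), (∀ u, h x + ⟪z, u - x⟫ ≤ h u) → ‖z‖ ≤ Gh)
    (hα0 : 0 < α) (hα1 : α < 1 / L)
    (prox : EuclideanSpace ℝ (Fin n) → EuclideanSpace ℝ (Fin n))
    (hprox : ∀ w z, h (prox w) + (1 / (2 * α)) * ‖prox w - w‖ ^ 2
      ≤ h z + (1 / (2 * α)) * ‖z - w‖ ^ 2)
    (hproxuniq : ∀ w z, (∀ u, h z + (1 / (2 * α)) * ‖z - w‖ ^ 2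
      ≤ h u + (1 / (2 * α)) * ‖u - w‖ ^ 2) → z = prox w)
    (lam : ℕ → Fin m → Fin m → ℝ) (Γ γ : ℝ) (hΓ : 0 < Γ) (hγ0 : 0 < γ) (hγ1 : γ < 1)
    (hlamnn : ∀ k, 2 ≤ k → ∀ i j, 0 ≤ lam k i j)
    (hrow : ∀ k, 2 ≤ k → ∀ i, ∑ j, lam k i j = 1)
    (hcol : ∀ k, 2 ≤ k → ∀ j, ∑ i, lam k i j = 1)
    (hmix : ∀ k, 2 ≤ k → ∀ i j, |lam k i j - 1 / (m : ℝ)| ≤ Γ * γ ^ k)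
    (x q v : ℕ → Fin m → EuclideanSpace ℝ (Fin n))
    (hq : ∀ k, 1 ≤ k → ∀ i, q (k + 1) i = x k i - α • G i (x k i))
    (hv : ∀ k, 1 ≤ k → ∀ i, v (k + 1) i = ∑ j, lam (k + 1) i j • q (k + 1) j)
    (hx : ∀ k, 1 ≤ k → ∀ i, x (k + 1) i = prox (v (k + 1) i))
    :
    ∀ k, 3 ≤ k →
      (∑ i, ‖x k i - x (k - 1) i‖
        ≤ 2 * m * Γ * γ ^ (k - 1) * ∑ i, ‖q (k - 1) i‖ + α * m * (Gg + Gh)) ∧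
      (∑ i, ‖x k i - x (k - 1) i‖
        ≤ 2 * m * Γ * ∑ l ∈ Finset.Icc 2 (k - 1), γ ^ l * ∑ i, ‖q l i‖
          + ((k : ℝ) - 1) * α * m * (Gg + Gh)) := by
  intro k hk
  obtain ⟨r, rfl⟩ : ∃ r, k = r + 1 + 1 := ⟨k - 2, by omega⟩
  have hr : 1 ≤ r := by omega
  have hGg0 : 0 ≤ Gg := (norm_nonneg _).trans (hGg ⟨0, hm⟩ 0)
  simp only [Nat.add_sub_cancel]
  set S := ∑ i, ‖q (r + 1) i‖
  have hdisagree : ∀ i j, ‖x (r + 1) j - x (r + 1) i‖ ≤ 2 * (Γ * γ ^ (r + 1)) * S := by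
    intro i j
    rw [hx r hr, hx r hr]
    refine (prox_nonexpansive hconv hα0 (hprox _) (hprox _)).trans ?_
    rw [hv r hr, hv r hr]
    exact norm_sum_smul_sub_sum_smul_le (hmix _ (by omega) j) (hmix _ (by omega) i) _
  have hstep : ∀ i, ‖x (r + 1 + 1) i - x (r + 1) i‖
      ≤ 2 * (Γ * γ ^ (r + 1)) * S + α * Gg + α * Gh := by
    intro i
    have hproxstep : ‖x (r + 1 + 1) i - v (r + 1 + 1) i‖ ≤ α * Gh := by
      rw [hx (r + 1) (by omega), norm_sub_rev]
      have hz := hsub _ _ (prox_subgradient hconv hα0 (hprox (v (r + 1 + 1) i)))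
      rwa [norm_smul, Real.norm_of_nonneg (inv_pos.2 hα0).le, inv_mul_le_iff₀ hα0] at hz
    have havg : ‖v (r + 1 + 1) i - x (r + 1) i‖ ≤ 2 * (Γ * γ ^ (r + 1)) * S + α * Gg := by
      rw [hv (r + 1) (by omega)]
      refine norm_sum_smul_sub_le (hlamnn _ (by omega) i) (hrow _ (by omega) i) fun j ↦ ?_
      rw [hq (r + 1) (by omega), sub_right_comm]
      refine (norm_sub_le _ _).trans (add_le_add (hdisagree i j) ?_)
      rw [norm_smul, Real.norm_of_nonneg hα0.le]
      exact mul_le_mul_of_nonneg_left (hGg _ _) hα0.le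
    linarith [norm_sub_le_norm_sub_add_norm_sub (x (r + 1 + 1) i) (v (r + 1 + 1) i) (x (r + 1) i)]
  have hfirst : ∑ i, ‖x (r + 1 + 1) i - x (r + 1) i‖
      ≤ 2 * m * Γ * γ ^ (r + 1) * S + α * m * (Gg + Gh) := by
    refine (Finset.sum_le_card_nsmul _ _ _ fun i _ ↦ hstep i).trans_eq ?_
    rw [Finset.card_univ, Fintype.card_fin, nsmul_eq_mul]
    ring
  refine ⟨hfirst, hfirst.trans (add_le_add ?_ ?_)⟩
  · rw [mul_assoc (2 * m * Γ)]
    refine mul_le_mul_of_nonneg_left ?_ (by positivity)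
    exact Finset.single_le_sum (f := fun l ↦ γ ^ l * ∑ i, ‖q l i‖)
      (fun l _ ↦ by positivity) (Finset.mem_Icc.2 ⟨by omega, le_rfl⟩)
  · have hc : 0 ≤ α * m * (Gg + Gh) := by positivity
    push_cast
    nlinarith [mul_nonneg (Nat.cast_nonneg (α := ℝ) r) hc]
end

section
/- For every k ≥ 2, the averaged iterates of the distributed proximal gradient algorithm satisfy ‖x̄_{k+1} − x̄_k‖ ≤ 2Γ γ^k ∑_{j=1}^m ‖q_{j,k}‖ + α (G_g + G_h), where x̄_k = (1/m)∑_{i=1}^m x_{i,k}. -/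
open scoped RealInnerProductSpace
open Filter

/-- First-order optimality for the proximal map: if `p` minimizes
`z ↦ h z + ‖z - w‖ ^ 2 / (2 * α)`, then `α⁻¹ • (w - p)` is a subgradient of `h` at `p`. -/
theorem subgradient_of_prox_minimizer {E : Type*} [NormedAddCommGroup E] [InnerProductSpace ℝ E]
    {h : E → ℝ} (hconv : ConvexOn ℝ Set.univ h) {α : ℝ} (hα : 0 < α) {w p : E}
    (hp : ∀ z, h p + (1 / (2 * α)) * ‖p - w‖ ^ 2 ≤ h z + (1 / (2 * α)) * ‖z - w‖ ^ 2) (u : E) :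
    h p + ⟪α⁻¹ • (w - p), u - p⟫ ≤ h u := by
  have key : ∀ t : ℝ, 0 < t → t ≤ 1 →
      0 ≤ (h u - h p - ⟪α⁻¹ • (w - p), u - p⟫) + t * (1 / (2 * α) * ‖u - p‖ ^ 2) := by
    intro t ht0 ht1
    have hmin := hp ((1 - t) • p + t • u)
    have hcvx := hconv.2 (Set.mem_univ p) (Set.mem_univ u) (sub_nonneg.2 ht1) ht0.le (by ring)
    have hsplit : (1 - t) • p + t • u - w = (p - w) + t • (u - p) := by module
    have hinner : ⟪α⁻¹ • (w - p), u - p⟫ = -(α⁻¹ * ⟪p - w, u - p⟫) := by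
      rw [real_inner_smul_left, ← neg_sub p w, inner_neg_left, mul_neg]
    rw [hsplit, norm_add_sq_real, norm_smul, mul_pow, Real.norm_eq_abs, sq_abs,
      real_inner_smul_right] at hmin
    simp only [smul_eq_mul] at hcvx
    rw [hinner]
    refine nonneg_of_mul_nonneg_right (a := t) ?_ ht0
    have hexpand : 1 / (2 * α) * (‖p - w‖ ^ 2 + 2 * (t * ⟪p - w, u - p⟫) + t ^ 2 * ‖u - p‖ ^ 2)
        = 1 / (2 * α) * ‖p - w‖ ^ 2 + t * (α⁻¹ * ⟪p - w, u - p⟫)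
          + t * (t * (1 / (2 * α) * ‖u - p‖ ^ 2)) := by
      field_simp
    rw [hexpand] at hmin
    linarith
  by_contra! hlt
  set A := h u - h p - ⟪α⁻¹ • (w - p), u - p⟫ with hA
  set B := 1 / (2 * α) * ‖u - p‖ ^ 2 with hB
  have hA0 : A < 0 := by linarith
  have hB0 : 0 ≤ B := by positivity
  have hBA : 0 < B - A := by linarith
  have hbad := key (-A / (B - A)) (div_pos (neg_pos.2 hA0) hBA)
    ((div_le_one hBA).2 (by linarith))
  have hval : A + -A / (B - A) * B = -(A ^ 2 / (B - A)) := by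
    field_simp
    ring
  have : 0 < A ^ 2 / (B - A) := div_pos (sq_pos_of_neg hA0) hBA
  linarith

/-- An average of vectors of norm at most `C` has norm at most `C`. -/
theorem norm_average_le {E : Type*} [NormedAddCommGroup E] [NormedSpace ℝ E] {m : ℕ} (hm : 1 ≤ m)
    {f : Fin m → E} {C : ℝ} (hf : ∀ i, ‖f i‖ ≤ C) : ‖(m : ℝ)⁻¹ • ∑ i, f i‖ ≤ C := by
  have hm0 : (0 : ℝ) < m := by exact_mod_cast hm
  rw [norm_smul, norm_inv, Real.norm_natCast, inv_mul_le_iff₀ hm0]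
  simpa using norm_sum_le_of_le Finset.univ fun i _ => hf i

theorem stmt_11
    (n m : ℕ) (hn : 0 < n) (hm : 1 ≤ m)
    (g : Fin m → EuclideanSpace ℝ (Fin n) → ℝ)
    (G : Fin m → EuclideanSpace ℝ (Fin n) → EuclideanSpace ℝ (Fin n))
    (L Gg Gh α : ℝ) (hL : 0 < L)
    (hgrad : ∀ i x, HasGradientAt (g i) (G i x) x)
    (hLip : ∀ i x y, ‖G i x - G i y‖ ≤ L * ‖x - y‖)
    (hGg : ∀ i x, ‖G i x‖ ≤ Gg)
    (h : EuclideanSpace ℝ (Fin n) → ℝ)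
    (hconv : ConvexOn ℝ Set.univ h)
    (hGh : 0 < Gh)
    (hsub : ∀ x z : EuclideanSpace ℝ (Fin n), (∀ u, h x + ⟪z, u - x⟫ ≤ h u) → ‖z‖ ≤ Gh)
    (hα0 : 0 < α) (hα1 : α < 1 / L)
    (prox : EuclideanSpace ℝ (Fin n) → EuclideanSpace ℝ (Fin n))
    (hprox : ∀ w z, h (prox w) + (1 / (2 * α)) * ‖prox w - w‖ ^ 2
      ≤ h z + (1 / (2 * α)) * ‖z - w‖ ^ 2)
    (hproxuniq : ∀ w z, (∀ u, h z + (1 / (2 * α)) * ‖z - w‖ ^ 2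
      ≤ h u + (1 / (2 * α)) * ‖u - w‖ ^ 2) → z = prox w)
    (lam : ℕ → Fin m → Fin m → ℝ) (Γ γ : ℝ) (hΓ : 0 < Γ) (hγ0 : 0 < γ) (hγ1 : γ < 1)
    (hlamnn : ∀ k, 2 ≤ k → ∀ i j, 0 ≤ lam k i j)
    (hrow : ∀ k, 2 ≤ k → ∀ i, ∑ j, lam k i j = 1)
    (hcol : ∀ k, 2 ≤ k → ∀ j, ∑ i, lam k i j = 1)
    (hmix : ∀ k, 2 ≤ k → ∀ i j, |lam k i j - 1 / (m : ℝ)| ≤ Γ * γ ^ k)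
    (x q v : ℕ → Fin m → EuclideanSpace ℝ (Fin n))
    (hq : ∀ k, 1 ≤ k → ∀ i, q (k + 1) i = x k i - α • G i (x k i))
    (hv : ∀ k, 1 ≤ k → ∀ i, v (k + 1) i = ∑ j, lam (k + 1) i j • q (k + 1) j)
    (hx : ∀ k, 1 ≤ k → ∀ i, x (k + 1) i = prox (v (k + 1) i))
    (xbar : ℕ → EuclideanSpace ℝ (Fin n))
    (hxbar : ∀ k, xbar k = (m : ℝ)⁻¹ • ∑ i, x k i)
    :
    ∀ k, 2 ≤ k →
      ‖xbar (k + 1) - xbar k‖ ≤ 2 * Γ * γ ^ k * ∑ j, ‖q k j‖ + α * (Gg + Gh) := by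
  intro k hk
  have hk1 : 1 ≤ k := by lia
  have hsubgrad : ∀ i, ‖α⁻¹ • (v (k + 1) i - x (k + 1) i)‖ ≤ Gh := by
    intro i
    rw [hx k hk1 i]
    exact hsub _ _ (subgradient_of_prox_minimizer hconv hα0 (hprox _))
  have hvsum : ∑ i, v (k + 1) i = ∑ i, q (k + 1) i := by
    simp_rw [hv k hk1]
    rw [Finset.sum_comm]
    refine Finset.sum_congr rfl fun j _ => ?_
    rw [← Finset.sum_smul, hcol (k + 1) (by lia) j, one_smul]
  have hstep : xbar (k + 1) - xbar k = (m : ℝ)⁻¹ •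
      ∑ i, -(α • (G i (x k i) + α⁻¹ • (v (k + 1) i - x (k + 1) i))) := by
    rw [hxbar, hxbar, ← smul_sub]
    congr 1
    simp only [smul_add, smul_inv_smul₀ hα0.ne', Finset.sum_neg_distrib, Finset.sum_add_distrib,
      Finset.sum_sub_distrib, hvsum, hq k hk1]
    abel
  have hbound : ‖xbar (k + 1) - xbar k‖ ≤ α * (Gg + Gh) := by
    rw [hstep]
    refine norm_average_le hm fun i => ?_
    rw [norm_neg, norm_smul, Real.norm_of_nonneg hα0.le]
    gcongr
    exact norm_add_le_of_le (hGg i _) (hsubgrad i)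
  have hnonneg : 0 ≤ 2 * Γ * γ ^ k * ∑ j, ‖q k j‖ := by positivity
  linarith
end

section
/- For every k ≥ 1, the averaged iterates of the distributed proximal gradient algorithm satisfy the descent inequality f(x̄_{k+1}) ≤ f(x̄_k) − (1/(2α) − L/2) ‖x̄_{k+1} − x̄_k‖² + ε_{k+1} − ⟨e_{k+1}, x̄_{k+1} − x̄_k⟩. -/
open scoped RealInnerProductSpace
open Filter

section Convex

variable {E : Type*} [NormedAddCommGroup E] [InnerProductSpace ℝ E]

/-- A real convex function on a finite-dimensional space has a subgradient at every point. -/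
theorem ConvexOn.exists_subgradient [FiniteDimensional ℝ E] {h : E → ℝ}
    (hconv : ConvexOn ℝ Set.univ h) (x : E) :
    ∃ z : E, ∀ u, h x + ⟪z, u - x⟫ ≤ h u := by
  have hcont : Continuous h := continuousOn_univ.1 (hconv.continuousOn isOpen_univ)
  have hopen : IsOpen {p : E × ℝ | p.1 ∈ Set.univ ∧ h p.1 < p.2} := by
    simpa using isOpen_lt (hcont.comp continuous_fst) continuous_snd
  obtain ⟨F, hF⟩ := geometric_hahn_banach_open_point (x := (x, h x))
    hconv.convex_strict_epigraph hopen (by simp)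
  have hsplit (u : E) (t : ℝ) : F (u, t) = F (u, 0) + t * F (0, 1) := by
    rw [← smul_eq_mul, ← map_smul, ← map_add]
    simp
  have hc : F (0, 1) < 0 := by
    have := hF (x, h x + 1) (by simp)
    rw [hsplit, hsplit x (h x)] at this
    linarith
  let ℓ : E →L[ℝ] ℝ := F.comp (ContinuousLinearMap.inl ℝ E ℝ)
  have : CompleteSpace E := FiniteDimensional.complete ℝ E
  refine ⟨(-F (0, 1))⁻¹ • (InnerProductSpace.toDual ℝ E).symm ℓ, fun u => ?_⟩
  have hℓ : ⟪(InnerProductSpace.toDual ℝ E).symm ℓ, u - x⟫ = F (u, 0) - F (x, 0) := by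
    rw [InnerProductSpace.toDual_symm_apply, map_sub]
    simp [ℓ]
  refine le_of_forall_gt_imp_ge_of_dense fun t ht => ?_
  have hlt := hF (u, t) (by simpa using ht)
  rw [hsplit, hsplit x (h x)] at hlt
  rw [real_inner_smul_left, hℓ, ← le_sub_iff_add_le', inv_mul_le_iff₀ (by linarith)]
  linarith

/-- A convex function whose subgradients are bounded by `C` is `C`-Lipschitz. -/
theorem ConvexOn.sub_le_of_subgradient_bound [FiniteDimensional ℝ E] {h : E → ℝ} {C : ℝ}
    (hconv : ConvexOn ℝ Set.univ h)
    (hsub : ∀ x z : E, (∀ u, h x + ⟪z, u - x⟫ ≤ h u) → ‖z‖ ≤ C) (x y : E) :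
    h x - h y ≤ C * ‖x - y‖ := by
  obtain ⟨z, hz⟩ := hconv.exists_subgradient x
  have hinner : ⟪z, x - y⟫ ≤ C * ‖x - y‖ :=
    (real_inner_le_norm z (x - y)).trans
      (mul_le_mul_of_nonneg_right (hsub x z hz) (norm_nonneg _))
  have hy := hz y
  rw [← neg_sub x y, inner_neg_right] at hy
  linarith

/-- The quadratic upper bound for a function with Lipschitz gradient. -/
theorem le_quadratic_of_lipschitz_gradient [CompleteSpace E] {g : E → ℝ} {G : E → E} {L : ℝ}
    (hgrad : ∀ x, HasGradientAt g (G x) x)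
    (hLip : ∀ x y, ‖G x - G y‖ ≤ L * ‖x - y‖) (x y : E) :
    g y ≤ g x + ⟪G x, y - x⟫ + L / 2 * ‖y - x‖ ^ 2 := by
  let φ : ℝ → ℝ := fun t =>
    g (x + t • (y - x)) - t * ⟪G x, y - x⟫ - t ^ 2 * (L / 2 * ‖y - x‖ ^ 2)
  have hφ (t : ℝ) : HasDerivAt φ (⟪G (x + t • (y - x)), y - x⟫ - 1 * ⟪G x, y - x⟫
      - (2 * t) * (L / 2 * ‖y - x‖ ^ 2)) t := by
    have hline : HasDerivAt (fun t : ℝ => x + t • (y - x)) (y - x) t := by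
      simpa using ((hasDerivAt_id t).smul_const (y - x)).const_add x
    have hg : HasDerivAt (fun t : ℝ => g (x + t • (y - x)))
        ⟪G (x + t • (y - x)), y - x⟫ t := by
      simpa [Function.comp_def] using
        (hgrad (x + t • (y - x))).hasFDerivAt.comp_hasDerivAt t hline
    have hsq : HasDerivAt (fun t : ℝ => t ^ 2) (2 * t) t := by
      simpa using hasDerivAt_pow 2 t
    exact (hg.sub ((hasDerivAt_id t).mul_const _)).sub (hsq.mul_const _)
  have hanti : AntitoneOn φ (Set.Icc 0 1) := by
    refine antitoneOn_of_deriv_nonpos (convex_Icc 0 1)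
      (fun t _ => (hφ t).continuousAt.continuousWithinAt)
      (fun t _ => (hφ t).differentiableAt.differentiableWithinAt) fun t ht => ?_
    rw [interior_Icc] at ht
    have hnorm : ‖G (x + t • (y - x)) - G x‖ ≤ L * (t * ‖y - x‖) := by
      simpa [norm_smul, abs_of_pos ht.1] using hLip (x + t • (y - x)) x
    have hinner : ⟪G (x + t • (y - x)) - G x, y - x⟫ ≤ L * (t * ‖y - x‖) * ‖y - x‖ :=
      (real_inner_le_norm _ _).trans (mul_le_mul_of_nonneg_right hnorm (norm_nonneg _))
    rw [inner_sub_left] at hinner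
    rw [(hφ t).deriv]
    linarith
  have h01 := hanti (Set.left_mem_Icc.2 zero_le_one) (Set.right_mem_Icc.2 zero_le_one) zero_le_one
  simp only [φ, one_smul, zero_smul, add_sub_cancel, add_zero] at h01
  linarith

/-- Averaging the quadratic upper bounds of finitely many functions with Lipschitz gradients. -/
theorem average_le_quadratic_of_lipschitz_gradient [CompleteSpace E] {m : ℕ} (hm : 1 ≤ m)
    {g : Fin m → E → ℝ} {G : Fin m → E → E} {L : ℝ}
    (hgrad : ∀ i x, HasGradientAt (g i) (G i x) x)
    (hLip : ∀ i x y, ‖G i x - G i y‖ ≤ L * ‖x - y‖) (x y : E) :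
    (m : ℝ)⁻¹ * ∑ i, g i y ≤ (m : ℝ)⁻¹ * ∑ i, g i x + ⟪(m : ℝ)⁻¹ • ∑ i, G i x, y - x⟫
      + L / 2 * ‖y - x‖ ^ 2 := by
  have hm0 : (m : ℝ) ≠ 0 := by positivity
  have hsum := Finset.sum_le_sum fun i (_ : i ∈ Finset.univ) =>
    le_quadratic_of_lipschitz_gradient (hgrad i) (hLip i) x y
  have hmul := mul_le_mul_of_nonneg_left hsum (inv_nonneg.2 (Nat.cast_nonneg (α := ℝ) m))
  rw [Finset.sum_add_distrib, Finset.sum_add_distrib, Finset.sum_const, Finset.card_univ,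
    Fintype.card_fin, nsmul_eq_mul, mul_add, mul_add, inv_mul_cancel_left₀ hm0] at hmul
  rwa [real_inner_smul_left, sum_inner]

/-- A point `y` near the proximal point `z` of `x - α • d` almost satisfies the proximal descent
inequality, up to an error controlled by `‖y - z‖`. -/
theorem inexact_prox_descent {h : E → ℝ} {α C : ℝ} (hα : 0 < α) {x y z d : E}
    (hlip : h y - h z ≤ C * ‖y - z‖)
    (hz : h z + (1 / (2 * α)) * ‖z - (x - α • d)‖ ^ 2
      ≤ h x + (1 / (2 * α)) * ‖x - (x - α • d)‖ ^ 2) :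
    h y + ⟪d, y - x⟫ + 1 / (2 * α) * ‖y - x‖ ^ 2 ≤ h x
      + (‖y - z‖ * (C + α⁻¹ * ‖z - (x - α • d)‖) + (1 / (2 * α)) * ‖y - z‖ ^ 2) := by
  set w := x - α • d with hw
  have hxw : ‖x - w‖ ^ 2 = ‖α • d‖ ^ 2 := by simp [hw]
  have hyw : ‖y - w‖ ^ 2 = ‖y - x‖ ^ 2 + 2 * (α * ⟪d, y - x⟫) + ‖α • d‖ ^ 2 := by
    rw [← real_inner_smul_left, real_inner_comm, ← norm_add_sq_real]
    congr 2
    rw [hw]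
    abel
  have hyzw : ‖y - w‖ ^ 2 = ‖y - z‖ ^ 2 + 2 * ⟪y - z, z - w⟫ + ‖z - w‖ ^ 2 := by
    rw [← norm_add_sq_real, sub_add_sub_cancel]
  have hcs : α⁻¹ * ⟪y - z, z - w⟫ ≤ α⁻¹ * (‖y - z‖ * ‖z - w‖) :=
    mul_le_mul_of_nonneg_left (real_inner_le_norm _ _) (inv_nonneg.2 hα.le)
  have hkey := congrArg (fun s => 1 / (2 * α) * s) (hyw.symm.trans hyzw)
  have hcancel : 1 / (2 * α) * (2 * (α * ⟪d, y - x⟫)) = ⟪d, y - x⟫ := by field_simp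
  have hhalf : 1 / (2 * α) * (2 * ⟪y - z, z - w⟫) = α⁻¹ * ⟪y - z, z - w⟫ := by field_simp
  simp only [mul_add, hcancel, hhalf] at hkey
  rw [hxw] at hz
  linarith

/-- Mixing with a matrix whose columns sum to one preserves the total. -/
theorem sum_mix_eq_sum {ι : Type*} [Fintype ι] {w : ι → ι → ℝ} (hw : ∀ j, ∑ i, w i j = 1)
    (q : ι → E) : ∑ i, ∑ j, w i j • q j = ∑ j, q j := by
  rw [Finset.sum_comm]
  simp [← Finset.sum_smul, hw]

end Convex

theorem stmt_13
    (n m : ℕ) (hn : 0 < n) (hm : 1 ≤ m)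
    (g : Fin m → EuclideanSpace ℝ (Fin n) → ℝ)
    (G : Fin m → EuclideanSpace ℝ (Fin n) → EuclideanSpace ℝ (Fin n))
    (L Gg Gh α : ℝ) (hL : 0 < L)
    (hgrad : ∀ i x, HasGradientAt (g i) (G i x) x)
    (hLip : ∀ i x y, ‖G i x - G i y‖ ≤ L * ‖x - y‖)
    (hGg : ∀ i x, ‖G i x‖ ≤ Gg)
    (h : EuclideanSpace ℝ (Fin n) → ℝ)
    (hconv : ConvexOn ℝ Set.univ h)
    (hGh : 0 < Gh)
    (hsub : ∀ x z : EuclideanSpace ℝ (Fin n), (∀ u, h x + ⟪z, u - x⟫ ≤ h u) → ‖z‖ ≤ Gh)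
    (hα0 : 0 < α) (hα1 : α < 1 / L)
    (prox : EuclideanSpace ℝ (Fin n) → EuclideanSpace ℝ (Fin n))
    (hprox : ∀ w z, h (prox w) + (1 / (2 * α)) * ‖prox w - w‖ ^ 2
      ≤ h z + (1 / (2 * α)) * ‖z - w‖ ^ 2)
    (hproxuniq : ∀ w z, (∀ u, h z + (1 / (2 * α)) * ‖z - w‖ ^ 2
      ≤ h u + (1 / (2 * α)) * ‖u - w‖ ^ 2) → z = prox w)
    (lam : ℕ → Fin m → Fin m → ℝ) (Γ γ : ℝ) (hΓ : 0 < Γ) (hγ0 : 0 < γ) (hγ1 : γ < 1)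
    (hlamnn : ∀ k, 2 ≤ k → ∀ i j, 0 ≤ lam k i j)
    (hrow : ∀ k, 2 ≤ k → ∀ i, ∑ j, lam k i j = 1)
    (hcol : ∀ k, 2 ≤ k → ∀ j, ∑ i, lam k i j = 1)
    (hmix : ∀ k, 2 ≤ k → ∀ i j, |lam k i j - 1 / (m : ℝ)| ≤ Γ * γ ^ k)
    (x q v : ℕ → Fin m → EuclideanSpace ℝ (Fin n))
    (hq : ∀ k, 1 ≤ k → ∀ i, q (k + 1) i = x k i - α • G i (x k i))
    (hv : ∀ k, 1 ≤ k → ∀ i, v (k + 1) i = ∑ j, lam (k + 1) i j • q (k + 1) j)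
    (hx : ∀ k, 1 ≤ k → ∀ i, x (k + 1) i = prox (v (k + 1) i))
    (xbar : ℕ → EuclideanSpace ℝ (Fin n))
    (hxbar : ∀ k, xbar k = (m : ℝ)⁻¹ • ∑ i, x k i)
    (vbar zb : ℕ → EuclideanSpace ℝ (Fin n))
    (hvbar : ∀ k, vbar k = (m : ℝ)⁻¹ • ∑ i, v k i)
    (hzb : ∀ k, zb k = prox (vbar k))
    (gradg : EuclideanSpace ℝ (Fin n) → EuclideanSpace ℝ (Fin n))
    (hgradg : ∀ y, gradg y = (m : ℝ)⁻¹ • ∑ i, G i y)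
    (e : ℕ → EuclideanSpace ℝ (Fin n))
    (he : ∀ k, 1 ≤ k → e (k + 1) = (m : ℝ)⁻¹ • ∑ i, (G i (x k i) - G i (xbar k)))
    (eps : ℕ → ℝ)
    (heps : ∀ k, 1 ≤ k → eps (k + 1) =
      ‖xbar (k + 1) - zb (k + 1)‖ * (Gh + α⁻¹ * ‖zb (k + 1) - vbar (k + 1)‖)
        + (1 / (2 * α)) * ‖xbar (k + 1) - zb (k + 1)‖ ^ 2)
    (gavg f : EuclideanSpace ℝ (Fin n) → ℝ)
    (hgavg : ∀ y, gavg y = (m : ℝ)⁻¹ * ∑ i, g i y)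
    (hf : ∀ y, f y = gavg y + h y)
    :
    ∀ k, 1 ≤ k →
      f (xbar (k + 1)) ≤ f (xbar k)
        - (1 / (2 * α) - L / 2) * ‖xbar (k + 1) - xbar k‖ ^ 2
        + eps (k + 1) - ⟪e (k + 1), xbar (k + 1) - xbar k⟫ := by
  intro k hk
  have hvstep : vbar (k + 1) = xbar k - α • (gradg (xbar k) + e (k + 1)) := by
    have hgrade : gradg (xbar k) + e (k + 1) = (m : ℝ)⁻¹ • ∑ i, G i (x k i) := by
      rw [hgradg, he k hk, ← smul_add, ← Finset.sum_add_distrib]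
      simp
    rw [hgrade, hvbar, hxbar, smul_comm, ← smul_sub, Finset.smul_sum (r := α),
      ← Finset.sum_sub_distrib]
    simp_rw [hv k hk, ← hq k hk]
    rw [sum_mix_eq_sum (hcol (k + 1) (by lia))]
  have hmin := hprox (vbar (k + 1)) (xbar k)
  rw [← hzb, hvstep] at hmin
  have hprox_step := inexact_prox_descent hα0
    (hconv.sub_le_of_subgradient_bound hsub (xbar (k + 1)) (zb (k + 1))) hmin
  rw [← hvstep, ← heps k hk, inner_add_left] at hprox_step
  have hsmooth := average_le_quadratic_of_lipschitz_gradient hm hgrad hLip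
    (xbar k) (xbar (k + 1))
  rw [← hgavg, ← hgavg, ← hgradg] at hsmooth
  rw [hf, hf]
  linarith
end
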